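/- arXiv:2603.19806 — 2 statements merged into one kernel-verified Lean document; each statement's English description precedes it below -/
import Mathlib

section
/- Let k ∈ ℕ, let P be any deterministic parity automaton recognizing the chain language L(M^k_1,…,M^k_k), and let (Q',δ') be an SCC of P consisting only of reachable states such that, for some 1 ≤ i ≤ k and 1 ≤ j ≤ k, for every word w using only letters from {x_i,…,x_{k+1}} ∪ {y_j,…,y_{k+1}}, every run on w starting in any state of Q' stays within (Q',δ'). Then |Q'| ≥ 2^{k−max(i,j)}. -/
open Classical

/-! ## Infinite words, residuals, injections, natural colors -/

abbrev Word (α : Type) : Type := ℕ → α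

def wcat {α : Type} (l : List α) (w : Word α) : Word α :=
  fun n => if h : n < l.length then l.get ⟨n, h⟩ else w (n - l.length)

/-- The residual language of `L` over the finite word `l`. -/
def Residual {α : Type} (L : Set (Word α)) (l : List α) : Set (Word α) :=
  {w | wcat l w ∈ L}

def IsPrefixOfWord {α : Type} (l : List α) (w : Word α) : Prop :=
  ∀ (j : ℕ) (h : j < l.length), l.get ⟨j, h⟩ = w j

/-- The finite prefix `w₀ u₀ w₁ u₁ … u_{i-1} w_i` of the word obtained from `w`
by injecting the finite word `u i` directly after position `i`. -/
def injPrefix {α : Type} (w : Word α) (u : ℕ → List α) : ℕ → List α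
  | 0 => [w 0]
  | i + 1 => injPrefix w u i ++ u i ++ [w (i + 1)]

/-- `w'` results from `w` by residual-language-invariant (w.r.t. `L`) injections
of finite words at positions in `J`. -/
def ResultsFromInj {α : Type} (L : Set (Word α)) (J : Set ℕ) (w w' : Word α) : Prop :=
  ∃ u : ℕ → List α,
    (∀ i, i ∉ J → u i = []) ∧
    (∀ i, Residual L (injPrefix w u i) = Residual L (injPrefix w u i ++ u i)) ∧
    (∀ i, IsPrefixOfWord (injPrefix w u i ++ u i) w')

/-- The word `w` is at home in color `i` with respect to `L`. -/
def AtHome {α : Type} (L : Set (Word α)) : ℕ → Word α → Prop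
  | i, w =>
    ∃ J : Set ℕ, ∀ w', ResultsFromInj L J w w' →
      (∃ j, ∃ _ : j < i, AtHome L j w') ∨
      (w ∈ L ∧ w' ∈ L ∧ Even i) ∨
      (w ∉ L ∧ w' ∉ L ∧ ¬ Even i)
termination_by i _ => i

/-- The natural color of `w` w.r.t. `L`: the least color `w` is at home in. -/
noncomputable def NatColor {α : Type} (L : Set (Word α)) (w : Word α) : ℕ :=
  sInf {i | AtHome L i w}

/-- The chain language of the (1-indexed) chain `C 1 ⊃ C 2 ⊃ … ⊃ C n`:
the words `w` such that the largest `i` with `w ∈ C i` is even, or `w ∉ C 1`. -/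
def ChainLang {α : Type} (n : ℕ) (C : ℕ → Set (Word α)) : Set (Word α) :=
  {w | w ∉ C 1 ∨
       ∃ i, 1 ≤ i ∧ i ≤ n ∧ w ∈ C i ∧ Even i ∧ ∀ j, i < j → j ≤ n → w ∉ C j}

/-! ## Automata with transition-based acceptance -/

structure Automaton (α : Type) : Type 1 where
  Q : Type
  fin : Fintype Q
  init : Q
  trans : Q → α → Q → ℕ → Prop

noncomputable def Automaton.size {α : Type} (A : Automaton α) : ℕ :=
  @Fintype.card A.Q A.fin

def IsRun {α : Type} (A : Automaton α) (w : Word α) (π : ℕ → A.Q) (ρ : ℕ → ℕ) : Prop :=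
  π 0 = A.init ∧ ∀ i, A.trans (π i) (w i) (π (i + 1)) (ρ i)

def InfOcc (ρ : ℕ → ℕ) : Set ℕ := {c | ∀ N, ∃ n, N ≤ n ∧ ρ n = c}

/-- The least color occurring infinitely often exists and is even. -/
def AccColorSeq (ρ : ℕ → ℕ) : Prop :=
  ∃ c ∈ InfOcc ρ, Even c ∧ ∀ c' ∈ InfOcc ρ, c ≤ c'

def Accepts {α : Type} (A : Automaton α) (w : Word α) : Prop :=
  ∃ π ρ, IsRun A w π ρ ∧ AccColorSeq ρ

def Lang {α : Type} (A : Automaton α) : Set (Word α) := {w | Accepts A w}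

/-- Input-completeness plus: the color only depends on the source state and letter. -/
def IsParity {α : Type} (A : Automaton α) : Prop :=
  (∀ q x, ∃ q' c, A.trans q x q' c) ∧
  (∀ q x q₁ c₁ q₂ c₂, A.trans q x q₁ c₁ → A.trans q x q₂ c₂ → c₁ = c₂)

def Deterministic {α : Type} (A : Automaton α) : Prop :=
  ∀ q x, ∃! p : A.Q × ℕ, A.trans q x p.1 p.2

def IsDPW {α : Type} (A : Automaton α) : Prop := IsParity A ∧ Deterministic A

def IsCoBuchi {α : Type} (A : Automaton α) : Prop :=
  IsParity A ∧ ∀ q x q' c, A.trans q x q' c → c = 1 ∨ c = 2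

def IsDCW {α : Type} (A : Automaton α) : Prop := IsCoBuchi A ∧ Deterministic A

def adviceRun {α : Type} (A : Automaton α) (f : List α → A.Q) (w : Word α) : ℕ → A.Q
  | 0 => A.init
  | i + 1 => f (List.ofFn (fun j : Fin (i + 1) => w j.val))

/-- History-determinism via an advice function `f : α* → Q`. -/
def HistoryDet {α : Type} (A : Automaton α) : Prop :=
  ∃ f : List α → A.Q, ∀ w : Word α,
    ∃ ρ, IsRun A w (adviceRun A f w) ρ ∧ (AccColorSeq ρ ↔ w ∈ Lang A)

/-- History-deterministic co-Büchi automaton with transition-based acceptance. -/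
def IsHDCBW {α : Type} (A : Automaton α) : Prop := IsCoBuchi A ∧ HistoryDet A

def ReachableState {α : Type} (A : Automaton α) (q : A.Q) : Prop :=
  Relation.ReflTransGen (fun a b => ∃ x c, A.trans a x b c) A.init q

def TransStep {Q α : Type} (T : Set (Q × α × Q × ℕ)) (q q' : Q) : Prop :=
  ∃ x c, (q, x, q', c) ∈ T

/-- `(S, T)` is a (nonempty) strongly connected component of `A`. -/
def IsSCC {α : Type} (A : Automaton α) (S : Set A.Q) (T : Set (A.Q × α × A.Q × ℕ)) : Prop :=
  S.Nonempty ∧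
  (∀ t ∈ T, A.trans t.1 t.2.1 t.2.2.1 t.2.2.2) ∧
  (∀ t ∈ T, t.1 ∈ S ∧ t.2.2.1 ∈ S) ∧
  (∀ q ∈ S, ∀ q' ∈ S, Relation.ReflTransGen (TransStep T) q q')

/-- Every run on a word over the allowed letters that starts in `S`
stays within the subgraph `(S, T)`. -/
def RunStaysWithin {α : Type} (A : Automaton α) (S : Set A.Q)
    (T : Set (A.Q × α × A.Q × ℕ)) (Allowed : Set α) : Prop :=
  ∀ w : Word α, (∀ n, w n ∈ Allowed) →
    ∀ (π : ℕ → A.Q) (ρ : ℕ → ℕ), π 0 ∈ S →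
      (∀ i, A.trans (π i) (w i) (π (i + 1)) (ρ i)) →
      ∀ i, π i ∈ S ∧ (π i, w i, π (i + 1), ρ i) ∈ T
/-! ## Statement 0: the one-state parity language over {1,…,k} -/

/-- Words over `{1,…,k}` (letter `m : Fin k` denotes the number `m+1`) whose
minimal infinitely often occurring letter is even. -/
def ParityMinLang (k : ℕ) : Set (Word (Fin k)) :=
  {w | ∃ m : Fin k, (∀ N, ∃ n, N ≤ n ∧ w n = m) ∧ Even (m.val + 1) ∧
        ∀ m' : Fin k, (∀ N, ∃ n, N ≤ n ∧ w n = m') → m ≤ m'}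

/-! ## Statements 2–4: the alphabet {x₁,…,x_{k+1}, y₁,…,y_{k+1}} -/

/-- `Sum.inl m` is the letter `x_{m+1}`, `Sum.inr m` the letter `y_{m+1}`. -/
abbrev Sig1 (k : ℕ) : Type := Fin (k + 1) ⊕ Fin (k + 1)

def isXle (k j : ℕ) (c : Sig1 k) : Prop := ∃ m : Fin (k + 1), c = Sum.inl m ∧ m.val + 1 ≤ j
def isYle (k j : ℕ) (c : Sig1 k) : Prop := ∃ m : Fin (k + 1), c = Sum.inr m ∧ m.val + 1 ≤ j
def isXge (k i : ℕ) (c : Sig1 k) : Prop := ∃ m : Fin (k + 1), c = Sum.inl m ∧ i ≤ m.val + 1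
def isYge (k i : ℕ) (c : Sig1 k) : Prop := ∃ m : Fin (k + 1), c = Sum.inr m ∧ i ≤ m.val + 1

/-- `M^k_j`: the letters `x₁,…,x_j` together occur only finitely often, or
the letters `y₁,…,y_j` together occur only finitely often. -/
def Mlang (k j : ℕ) : Set (Word (Sig1 k)) :=
  {w | (∃ N, ∀ n, N ≤ n → ¬ isXle k j (w n)) ∨ (∃ N, ∀ n, N ≤ n → ¬ isYle k j (w n))}

/-! ## Statements 5–16: the alphabet {X₁,…,X_k, Y₁,…,Y_k, a₀,…,a_{4k−1}} -/

/-- `Sum.inl m` is `X_{m+1}`, `Sum.inr (Sum.inl m)` is `Y_{m+1}`,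
`Sum.inr (Sum.inr m)` is the letter `a_m`. -/
abbrev Sig2 (k : ℕ) : Type := Fin k ⊕ (Fin k ⊕ Fin (4 * k))

def isX2 (k i : ℕ) (c : Sig2 k) : Prop := ∃ m : Fin k, c = Sum.inl m ∧ m.val + 1 = i
def isY2 (k j : ℕ) (c : Sig2 k) : Prop := ∃ m : Fin k, c = Sum.inr (Sum.inl m) ∧ m.val + 1 = j
def isaLe2 (k j : ℕ) (c : Sig2 k) : Prop :=
  ∃ m : Fin (4 * k), c = Sum.inr (Sum.inr m) ∧ m.val ≤ j
def isaGe2 (k j : ℕ) (c : Sig2 k) : Prop :=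
  ∃ m : Fin (4 * k), c = Sum.inr (Sum.inr m) ∧ j ≤ m.val

/-- `L^k_i`: the words that eventually contain only letters from `{a₀,…,a_{4k−2i}}`,
together with the words that contain an even number of `X_i` letters and eventually
contain only letters from `{a₀,…,a_{4k−2i+1}}`. -/
def LL (k i : ℕ) : Set (Word (Sig2 k)) :=
  {w | (∃ N, ∀ n, N ≤ n → isaLe2 k (4 * k - 2 * i) (w n)) ∨
       ({n | isX2 k i (w n)}.Finite ∧ Even {n | isX2 k i (w n)}.ncard ∧
        ∃ N, ∀ n, N ≤ n → isaLe2 k (4 * k - 2 * i + 1) (w n))}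

/-- `\hat L^k_j`: the words that eventually contain only letters from
`{a_{2j−1},…,a_{4k−1}}`, together with the words that contain an even number of
`Y_j` letters and eventually contain only letters from `{a_{2j−2},…,a_{4k−1}}`. -/
def LLhat (k j : ℕ) : Set (Word (Sig2 k)) :=
  {w | (∃ N, ∀ n, N ≤ n → isaGe2 k (2 * j - 1) (w n)) ∨
       ({n | isY2 k j (w n)}.Finite ∧ Even {n | isY2 k j (w n)}.ncard ∧
        ∃ N, ∀ n, N ≤ n → isaGe2 k (2 * j - 2) (w n))}

def Lbig (k : ℕ) : Set (Word (Sig2 k)) := ChainLang k (LL k)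
def Lbighat (k : ℕ) : Set (Word (Sig2 k)) := ChainLang k (LLhat k)

/-- `L^k_i` extended by `L^k_0 = Σ^ω`. -/
def LL0 (k i : ℕ) : Set (Word (Sig2 k)) := if i = 0 then Set.univ else LL k i
def LLhat0 (k j : ℕ) : Set (Word (Sig2 k)) := if j = 0 then Set.univ else LLhat k j

/-- `p` is the unique greatest index pair of `w`. -/
def GreatestPair (k : ℕ) (w : Word (Sig2 k)) (p : ℕ × ℕ) : Prop :=
  p.1 ≤ k ∧ p.2 ≤ k ∧ w ∈ LL0 k p.1 ∧ w ∈ LLhat0 k p.2 ∧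
  ∀ i' j', i' ≤ k → j' ≤ k → w ∈ LL0 k i' → w ∈ LLhat0 k j' → i' ≤ p.1 ∧ j' ≤ p.2

/-- The sets `Γ^k_u`. -/
def GammaSet (k u : ℕ) : Set (ℕ × ℕ) :=
  if Even u then
    {p | p.1 ≤ k ∧ p.2 ≤ k ∧ p.1 + p.2 = u ∧ Even p.1 ∧ Even p.2}
  else
    {p | p.1 ≤ k ∧ p.2 ≤ k ∧ u ≤ p.1 + p.2 ∧ p.1 + p.2 ≤ u + 1 ∧ (Odd p.1 ∨ Odd p.2)}

/-- The number of occurrences of the letter `X_i` in a finite word. -/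
def countX (k i : ℕ) (u : List (Sig2 k)) : ℕ :=
  u.countP (fun c => match c with
    | Sum.inl m => decide (m.val + 1 = i)
    | _ => false)

/-! ## Statements 17–19: the alphabet {X₁,…,X_k, Y₁,…,Y_k, a₁,…,a_{2k+1}} -/

/-- `Sum.inl m` is `X_{m+1}`, `Sum.inr (Sum.inl m)` is `Y_{m+1}`,
`Sum.inr (Sum.inr m)` is the letter `a_{m+1}`. -/
abbrev Sig3 (k : ℕ) : Type := Fin k ⊕ (Fin k ⊕ Fin (2 * k + 1))

def isX3 (k i : ℕ) (c : Sig3 k) : Prop := ∃ m : Fin k, c = Sum.inl m ∧ m.val + 1 = i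
def isXany3 (k : ℕ) (c : Sig3 k) : Prop := ∃ m : Fin k, c = Sum.inl m
def isY3 (k j : ℕ) (c : Sig3 k) : Prop := ∃ m : Fin k, c = Sum.inr (Sum.inl m) ∧ m.val + 1 = j
def isa3 (k j : ℕ) (c : Sig3 k) : Prop :=
  ∃ m : Fin (2 * k + 1), c = Sum.inr (Sum.inr m) ∧ m.val + 1 = j
def isaGe3 (k j : ℕ) (c : Sig3 k) : Prop :=
  ∃ m : Fin (2 * k + 1), c = Sum.inr (Sum.inr m) ∧ j ≤ m.val + 1

/-- `N^k_i` (for `1 ≤ i ≤ k+1`): letters from `{X₁,…,X_k}` occur only finitely often,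
and when `i ≥ 2` additionally letters from `{a_{2k−2i+5},…,a_{2k+1}}` occur only
finitely often and either `a_{2k−2i+4}` occurs only finitely often or `X_{i−1}`
does not occur after the first occurrence of `Y_{i−1}`. -/
def NN (k i : ℕ) : Set (Word (Sig3 k)) :=
  {w | (∃ N, ∀ n, N ≤ n → ¬ isXany3 k (w n)) ∧
       (2 ≤ i →
         ((∃ N, ∀ n, N ≤ n → ¬ isaGe3 k (2 * k + 5 - 2 * i) (w n)) ∧
          ((∃ N, ∀ n, N ≤ n → ¬ isa3 k (2 * k + 4 - 2 * i) (w n)) ∨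
           (∀ n, (∃ m, m < n ∧ isY3 k (i - 1) (w m)) → ¬ isX3 k (i - 1) (w n)))))}

def Lbig3 (k : ℕ) : Set (Word (Sig3 k)) := ChainLang (k + 1) (NN k)

/-- The words with natural color `0` w.r.t. the complement of `L^k`:
every `Y_i` occurs and `X_i` never occurs after the first occurrence of `Y_i`,
and letters from `{a_{2k}, a_{2k+1}}` occur infinitely often. -/
def hatL0 (k : ℕ) : Set (Word (Sig3 k)) :=
  {w | (∀ i, 1 ≤ i → i ≤ k →
          (∃ n, isY3 k i (w n)) ∧
          (∀ n, (∃ m, m < n ∧ isY3 k i (w m)) → ¬ isX3 k i (w n))) ∧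
       (∀ N, ∃ n, N ≤ n ∧ isaGe3 k (2 * k) (w n))}

/-! ## Runs of deterministic transition functions -/

/-- The run of the transition function `d` from `q` on the infinite word `w`. -/
def runFrom {Q α : Type} (d : Q → α → Q) (q : Q) (w : Word α) : ℕ → Q
  | 0 => q
  | n + 1 => d (runFrom d q w n) (w n)

/-- The state-letter pairs visited by `d` from `q` while reading a finite word. -/
def trace {Q α : Type} (d : Q → α → Q) (q : Q) : List α → List (Q × α)
  | [] => []
  | a :: u => (q, a) :: trace d (d q a) u

/-- The infinite repetition of a nonempty finite word. -/
def omegaPow {α : Type} (u : List α) (hu : u ≠ []) : Word α :=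
  fun n => u[n % u.length]'(Nat.mod_lt _ (List.length_pos_iff.2 hu))

theorem trace_length {Q α : Type} (d : Q → α → Q) (u : List α) (q : Q) :
    (trace d q u).length = u.length := by
  induction u generalizing q with
  | nil => rfl
  | cons a u ih => simp [trace, ih]

theorem trace_append {Q α : Type} (d : Q → α → Q) (u v : List α) (q : Q) :
    trace d q (u ++ v) = trace d q u ++ trace d (u.foldl d q) v := by
  induction u generalizing q with
  | nil => rfl
  | cons a u ih => simp [trace, ih]

theorem trace_map_snd {Q α : Type} (d : Q → α → Q) (u : List α) (q : Q) :
    (trace d q u).map Prod.snd = u := by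
  induction u generalizing q with
  | nil => rfl
  | cons a u ih => simp [trace, ih]

theorem runFrom_succ {Q α : Type} (d : Q → α → Q) (q : Q) (w : Word α) (n : ℕ) :
    runFrom d q w (n + 1) = runFrom d (d q (w 0)) (fun m => w (m + 1)) n := by
  induction n with
  | zero => rfl
  | succ n ih => rw [runFrom, ih]; rfl

theorem wcat_cons_zero {α : Type} (a : α) (u : List α) (w : Word α) :
    wcat (a :: u) w 0 = a := by
  simp [wcat]

theorem wcat_cons_succ {α : Type} (a : α) (u : List α) (w : Word α) (n : ℕ) :
    wcat (a :: u) w (n + 1) = wcat u w n := by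
  simp [wcat]

theorem wcat_length_add {α : Type} (u : List α) (w : Word α) (n : ℕ) :
    wcat u w (u.length + n) = w n := by
  simp [wcat]

theorem runFrom_wcat {Q α : Type} (d : Q → α → Q) (u : List α) (w : Word α) (q : Q) (n : ℕ) :
    runFrom d q (wcat u w) (u.length + n) = runFrom d (u.foldl d q) w n := by
  induction u generalizing q with
  | nil =>
    have : wcat [] w = w := by funext m; simp [wcat]
    simp [this]
  | cons a u ih =>
    have : (a :: u).length + n = (u.length + n) + 1 := by simp; omega
    rw [this, runFrom_succ]
    simp only [wcat_cons_zero, wcat_cons_succ]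
    exact ih _

theorem runFrom_wcat_trace {Q α : Type} (d : Q → α → Q) (u : List α) (w : Word α) (q : Q) (n : ℕ)
    (hn : n < (trace d q u).length) :
    (runFrom d q (wcat u w) n, wcat u w n) = (trace d q u)[n] := by
  induction u generalizing q n with
  | nil => simp [trace] at hn
  | cons a u ih =>
    cases n with
    | zero => simp [trace, runFrom, wcat]
    | succ n =>
      rw [runFrom_succ]
      simp only [wcat_cons_zero, wcat_cons_succ, trace, List.getElem_cons_succ]
      exact ih _ _ _

theorem wcat_omegaPow {α : Type} (u : List α) (hu : u ≠ []) :
    wcat u (omegaPow u hu) = omegaPow u hu := by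
  funext n
  by_cases h : n < u.length
  · simp [wcat, omegaPow, h, Nat.mod_eq_of_lt h]
  · simp [wcat, omegaPow, h, ← Nat.mod_eq_sub_mod (not_lt.1 h)]

theorem runFrom_omegaPow {Q α : Type} (d : Q → α → Q) (u : List α) (hu : u ≠ []) (q : Q)
    (hq : u.foldl d q = q) (n : ℕ) (hn : n % u.length < (trace d q u).length) :
    (runFrom d q (omegaPow u hu) n, omegaPow u hu n) = (trace d q u)[n % u.length] := by
  induction n using Nat.strong_induction_on with
  | _ n ih =>
    by_cases h : n < u.length
    · have h' : n < (trace d q u).length := by rwa [trace_length]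
      have := runFrom_wcat_trace d u (omegaPow u hu) q n h'
      rw [wcat_omegaPow] at this
      simpa [Nat.mod_eq_of_lt h] using this
    · obtain ⟨m, rfl⟩ := Nat.exists_eq_add_of_le (not_lt.1 h)
      have hpos := List.length_pos_iff.2 hu
      have h1 := runFrom_wcat d u (omegaPow u hu) q m
      have h2 := wcat_length_add u (omegaPow u hu) m
      rw [wcat_omegaPow] at h1 h2
      rw [h1, h2, hq, ih m (by omega) (by simpa using hn)]
      simp

theorem infinitely_often_iff_mem {β : Type} (f : ℕ → β) (N : ℕ) (l : List β) (hl : l ≠ [])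
    (h : ∀ n (hn : n % l.length < l.length), f (N + n) = l[n % l.length]) (x : β) :
    (∀ M, ∃ n, M ≤ n ∧ f n = x) ↔ x ∈ l := by
  have hpos := List.length_pos_iff.2 hl
  constructor
  · intro H
    obtain ⟨n, hn, rfl⟩ := H N
    obtain ⟨m, rfl⟩ := Nat.exists_eq_add_of_le hn
    rw [h m (Nat.mod_lt _ hpos)]
    exact List.getElem_mem _
  · intro hx M
    obtain ⟨t, ht, rfl⟩ := List.getElem_of_mem hx
    have hmod : (t + l.length * M) % l.length = t := by
      rw [Nat.add_mul_mod_self_left, Nat.mod_eq_of_lt ht]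
    refine ⟨N + (t + l.length * M), ?_, ?_⟩
    · have := Nat.le_mul_of_pos_left M hpos
      omega
    · rw [h _ (Nat.mod_lt _ hpos)]
      simp only [hmod]

/-- The least element of the list exists and is even. -/
def EvenMin (l : List ℕ) : Prop := ∃ c ∈ l, Even c ∧ ∀ c' ∈ l, c ≤ c'

theorem exists_least_mem (l : List ℕ) (hl : l ≠ []) : ∃ c ∈ l, ∀ c' ∈ l, c ≤ c' := by
  obtain ⟨c, hc, h⟩ := l.toFinset.exists_minimal (by simpa using hl)
  refine ⟨c, by simpa using hc, fun c' hc' => ?_⟩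
  by_contra hlt
  exact hlt (h (by simpa using hc') (by omega))

theorem evenMin_iff {l : List ℕ} {c : ℕ} (hc : c ∈ l) (h : ∀ c' ∈ l, c ≤ c') :
    EvenMin l ↔ Even c := by
  constructor
  · rintro ⟨e, he, hev, hmin⟩
    rwa [le_antisymm (h e he) (hmin c hc)]
  · exact fun hev => ⟨c, hc, hev, h⟩

theorem evenMin_append {l₁ l₂ : List ℕ} (h₁ : l₁ ≠ []) (h₂ : l₂ ≠ []) (E : Prop)
    (e₁ : EvenMin l₁ ↔ E) (e₂ : EvenMin l₂ ↔ E) : EvenMin (l₁ ++ l₂) ↔ E := by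
  obtain ⟨c₁, m₁, b₁⟩ := exists_least_mem l₁ h₁
  obtain ⟨c₂, m₂, b₂⟩ := exists_least_mem l₂ h₂
  rcases le_total c₁ c₂ with h | h
  · rw [← e₁, evenMin_iff m₁ b₁]
    refine evenMin_iff (List.mem_append_left _ m₁) fun c' hc' => ?_
    rcases List.mem_append.1 hc' with h' | h'
    · exact b₁ _ h'
    · exact h.trans (b₂ _ h')
  · rw [← e₂, evenMin_iff m₂ b₂]
    refine evenMin_iff (List.mem_append_right _ m₂) fun c' hc' => ?_
    rcases List.mem_append.1 hc' with h' | h'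
    · exact h.trans (b₁ _ h')
    · exact b₂ _ h'

theorem infOcc_lasso {Q α : Type} (d : Q → α → Q) (p u : List α) (hu : u ≠ []) (q₀ : Q)
    (hq : u.foldl d (p.foldl d q₀) = p.foldl d q₀) {β : Type} (g : Q × α → β) (x : β) :
    (∀ M, ∃ n, M ≤ n ∧
      g (runFrom d q₀ (wcat p (omegaPow u hu)) n, wcat p (omegaPow u hu) n) = x) ↔
    x ∈ (trace d (p.foldl d q₀) u).map g := by
  have hlen := trace_length d u (p.foldl d q₀)
  refine infinitely_often_iff_mem _ p.length _ ?_ ?_ x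
  · rw [Ne, ← List.length_eq_zero_iff, List.length_map, hlen]
    simpa using hu
  · intro n hn
    rw [runFrom_wcat, wcat_length_add]
    have := runFrom_omegaPow d u hu _ hq n (by simpa [hlen] using hn)
    simp [this, hlen]

/-! ## Deterministic parity automata -/

/-- The transition function `d` and coloring `col` describe the automaton `A`. -/
def Describes {α : Type} (A : Automaton α) (d : A.Q → α → A.Q) (col : A.Q × α → ℕ) : Prop :=
  ∀ q x q' c, A.trans q x q' c ↔ q' = d q x ∧ c = col (q, x)

theorem Deterministic.exists_describes {α : Type} {A : Automaton α} (h : Deterministic A) :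
    ∃ d col, Describes A d col := by
  choose f hf hu using h
  refine ⟨fun q x => (f q x).1, fun p => (f p.1 p.2).2, fun q x q' c => ⟨fun ht => ?_, ?_⟩⟩
  · have := hu q x (q', c) ht
    simp [← this]
  · rintro ⟨rfl, rfl⟩
    exact hf q x

theorem Describes.accepts_iff {α : Type} {A : Automaton α} {d : A.Q → α → A.Q}
    {col : A.Q × α → ℕ} (h : Describes A d col) (w : Word α) :
    Accepts A w ↔ AccColorSeq fun n => col (runFrom d A.init w n, w n) := by
  constructor
  · rintro ⟨π, ρ, ⟨h0, hs⟩, hacc⟩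
    have hπ : π = runFrom d A.init w := by
      funext n
      induction n with
      | zero => exact h0
      | succ n ih => rw [((h _ _ _ _).1 (hs n)).1, ih, runFrom]
    have hρ : ρ = fun n => col (runFrom d A.init w n, w n) := by
      funext n
      rw [((h _ _ _ _).1 (hs n)).2, hπ]
    rwa [← hρ]
  · exact fun hacc => ⟨_, _, ⟨rfl, fun n => (h _ _ _ _).2 ⟨rfl, rfl⟩⟩, hacc⟩

theorem Describes.accepts_lasso_iff {α : Type} {A : Automaton α} {d : A.Q → α → A.Q}
    {col : A.Q × α → ℕ} (h : Describes A d col) (p u : List α) (hu : u ≠ [])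
    (hq : u.foldl d (p.foldl d A.init) = p.foldl d A.init) :
    Accepts A (wcat p (omegaPow u hu)) ↔
      EvenMin ((trace d (p.foldl d A.init) u).map col) := by
  rw [h.accepts_iff]
  have : InfOcc (fun n => col (runFrom d A.init (wcat p (omegaPow u hu)) n,
      wcat p (omegaPow u hu) n)) = {c | c ∈ (trace d (p.foldl d A.init) u).map col} :=
    Set.ext fun c => infOcc_lasso d p u hu A.init hq col c
  rw [AccColorSeq, this]
  rfl

theorem Describes.exists_word_of_reachable {α : Type} {A : Automaton α} {d : A.Q → α → A.Q}
    {col : A.Q × α → ℕ} (h : Describes A d col) {q : A.Q} (hq : ReachableState A q) :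
    ∃ p : List α, p.foldl d A.init = q := by
  induction hq with
  | refl => exact ⟨[], rfl⟩
  | tail _ hstep ih =>
    obtain ⟨p, rfl⟩ := ih
    obtain ⟨x, c, ht⟩ := hstep
    exact ⟨p ++ [x], by simp [((h _ _ _ _).1 ht).1]⟩

/-- `S` is closed under the letters satisfying `p`. -/
def ClosedUnder {Q α : Type} (d : Q → α → Q) (p : α → Prop) (S : Set Q) : Prop :=
  ∀ q ∈ S, ∀ x, p x → d q x ∈ S

theorem ClosedUnder.foldl_mem {Q α : Type} {d : Q → α → Q} {p : α → Prop} {S : Set Q}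
    (h : ClosedUnder d p S) (u : List α) (hu : ∀ x ∈ u, p x) {q : Q} (hq : q ∈ S) :
    u.foldl d q ∈ S := by
  induction u generalizing q with
  | nil => exact hq
  | cons a u ih =>
    exact ih (fun x hx => hu x (List.mem_cons_of_mem _ hx)) (h q hq a (hu a List.mem_cons_self))

/-- A closed set contains a closed set each of whose states lies on a loop
reading exactly the allowed letters. -/
theorem ClosedUnder.exists_loops {Q α : Type} [Finite Q] [Fintype α] {d : Q → α → Q}
    {p : α → Prop} {S : Set Q} (hS : S.Nonempty) (h : ClosedUnder d p S) :
    ∃ R ⊆ S, R.Nonempty ∧ ClosedUnder d p R ∧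
      ∀ q ∈ R, ∃ u : List α, (∀ x, x ∈ u ↔ p x) ∧ u.foldl d q = q := by
  obtain ⟨R, ⟨hRS, hR, hcl⟩, hmin⟩ :=
    (Set.toFinite {R : Set Q | R ⊆ S ∧ R.Nonempty ∧ ClosedUnder d p R}).exists_minimal
      ⟨S, subset_rfl, hS, h⟩
  refine ⟨R, hRS, hR, hcl, fun q hq => ?_⟩
  let v : List α := (Finset.univ.filter p).toList
  have hv : ∀ x, x ∈ v ↔ p x := by simp [v]
  have hr : v.foldl d q ∈ R := hcl.foldl_mem v (fun x => (hv x).1) hq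
  let W : Set Q := {r | ∃ u : List α, (∀ x ∈ u, p x) ∧ u.foldl d (v.foldl d q) = r}
  have hWR : W ⊆ R := by
    rintro _ ⟨u, hu, rfl⟩
    exact hcl.foldl_mem u hu hr
  have hW : ClosedUnder d p W := by
    rintro _ ⟨u, hu, rfl⟩ x hx
    refine ⟨u ++ [x], ?_, by simp⟩
    intro y hy
    rcases List.mem_append.1 hy with hy | hy
    · exact hu y hy
    · rwa [List.mem_singleton.1 hy]
  have hWne : W.Nonempty := ⟨_, [], by simp, rfl⟩
  obtain ⟨u, hu, hloop⟩ := hmin ⟨hWR.trans hRS, hWne, hW⟩ hWR hq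
  refine ⟨v ++ u, fun x => ?_, by simpa using hloop⟩
  rw [List.mem_append, hv]
  exact ⟨fun hx => hx.elim id (hu x), Or.inl⟩

/-! ## The chain language on ultimately periodic words -/

theorem chainLang_iff_odd {α : Type} (k m : ℕ) (C : ℕ → Set (Word α)) (w : Word α)
    (hm1 : 1 ≤ m) (hmk : m ≤ k + 1) (h : ∀ j, 1 ≤ j → j ≤ k → (w ∈ C j ↔ j < m))
    (h1 : w ∈ C 1 ↔ 1 < m) :
    w ∈ ChainLang k C ↔ Odd m := by
  constructor
  · rintro (h' | ⟨i, hi1, hik, hiC, hev, hmax⟩)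
    · rw [h1] at h'
      have : m = 1 := by omega
      simp [this]
    · have him := (h i hi1 hik).1 hiC
      have : m = i + 1 := by
        by_contra hne
        exact hmax (i + 1) (by omega) (by omega) ((h _ (by omega) (by omega)).2 (by omega))
      rw [this]
      exact hev.add_one
  · rintro ⟨t, ht⟩
    by_cases hm : m = 1
    · exact Or.inl (by rw [h1]; omega)
    · refine Or.inr ⟨2 * t, by omega, by omega, (h _ (by omega) (by omega)).2 (by omega),
        even_two_mul t, fun j hj hjk hjC => ?_⟩
      have := (h j (by omega) hjk).1 hjC
      omega

theorem eventually_not_iff {α : Type} (w : Word α) (u : List α) (p : α → Prop) [Finite α]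
    (h : ∀ x, (∀ M, ∃ n, M ≤ n ∧ w n = x) ↔ x ∈ u) :
    (∃ N, ∀ n, N ≤ n → ¬ p (w n)) ↔ ∀ x ∈ u, ¬ p x := by
  constructor
  · rintro ⟨N, hN⟩ x hx hpx
    obtain ⟨n, hn, rfl⟩ := (h x).2 hx N
    exact hN n hn hpx
  · intro hu
    have hfin : ∀ x : α, ∃ M, p x → ∀ n, M ≤ n → w n ≠ x := by
      intro x
      by_cases hx : x ∈ u
      · exact ⟨0, fun hpx => absurd hpx (hu x hx)⟩
      · rw [← h x] at hx
        push Not at hx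
        obtain ⟨M, hM⟩ := hx
        exact ⟨M, fun _ => hM⟩
    choose M hM using hfin
    obtain ⟨N, hN⟩ := (Set.finite_range M).bddAbove
    exact ⟨N, fun n hn hp => hM (w n) hp n ((hN ⟨_, rfl⟩).trans hn) rfl⟩

theorem mem_chainLang_iff_odd_max (k a b : ℕ) (w : Word (Sig1 k)) (u : List (Sig1 k))
    (hw : ∀ x, (∀ M, ∃ n, M ≤ n ∧ w n = x) ↔ x ∈ u)
    (hu : ∀ x, x ∈ u ↔ isXge k a x ∨ isYge k b x)
    (ha : 1 ≤ a) (hak : a ≤ k + 1) (hb : 1 ≤ b) (hbk : b ≤ k + 1) :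
    w ∈ ChainLang k (Mlang k) ↔ Odd (max a b) := by
  have key : ∀ j, w ∈ Mlang k j ↔ j < max a b := by
    intro j
    simp only [Mlang, Set.mem_ofPred_eq, eventually_not_iff w u _ hw, hu]
    rw [lt_max_iff]
    refine or_congr ⟨fun H => ?_, ?_⟩ ⟨fun H => ?_, ?_⟩
    · by_contra hj
      exact H (Sum.inl ⟨a - 1, by omega⟩) (Or.inl ⟨_, rfl, by simp only; omega⟩)
        ⟨_, rfl, by simp only; omega⟩
    · rintro hj x (⟨m, rfl, hm⟩ | ⟨m, rfl, hm⟩) ⟨m', he, hm'⟩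
      · cases he; omega
      · cases he
    · by_contra hj
      exact H (Sum.inr ⟨b - 1, by omega⟩) (Or.inr ⟨_, rfl, by simp only; omega⟩)
        ⟨_, rfl, by simp only; omega⟩
    · rintro hj x (⟨m, rfl, hm⟩ | ⟨m, rfl, hm⟩) ⟨m', he, hm'⟩
      · cases he
      · cases he; omega
  exact chainLang_iff_odd k _ _ w (by omega) (by omega) (fun j _ _ => key j) (key 1)

/-- On a reachable loop reading exactly `x_a, …, x_{k+1}, y_b, …, y_{k+1}`, the parity of the
least color is determined by `max a b`. -/
theorem Describes.evenMin_loop_iff {k : ℕ} {P : Automaton (Sig1 k)}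
    {d : P.Q → Sig1 k → P.Q} {col : P.Q × Sig1 k → ℕ} (h : Describes P d col)
    (hlang : Lang P = ChainLang k (Mlang k)) {q : P.Q} (hq : ReachableState P q)
    (u : List (Sig1 k)) (hloop : u.foldl d q = q) (hne : u ≠ []) (a b : ℕ)
    (hu : ∀ x, x ∈ u ↔ isXge k a x ∨ isYge k b x)
    (ha : 1 ≤ a) (hak : a ≤ k + 1) (hb : 1 ≤ b) (hbk : b ≤ k + 1) :
    EvenMin ((trace d q u).map col) ↔ Odd (max a b) := by
  obtain ⟨p, rfl⟩ := h.exists_word_of_reachable hq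
  rw [← h.accepts_lasso_iff p u hne hloop]
  change _ ∈ Lang P ↔ _
  rw [hlang]
  refine mem_chainLang_iff_odd_max k a b _ u (fun x => ?_) hu ha hak hb hbk
  have := infOcc_lasso d p u hne P.init hloop Prod.snd x
  rwa [trace_map_snd] at this

/-- A nonempty set of reachable states closed under `x_a, …, x_{k+1}, y_b, …, y_{k+1}` has at
least as many states as the Zielonka tree of the restricted condition has leaves. -/
theorem Describes.two_pow_le_ncard {k : ℕ} {P : Automaton (Sig1 k)}
    {d : P.Q → Sig1 k → P.Q} {col : P.Q × Sig1 k → ℕ} (h : Describes P d col)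
    (hlang : Lang P = ChainLang k (Mlang k)) (n a b : ℕ) (hn : max a b + n = k + 1)
    (ha : 1 ≤ a) (hb : 1 ≤ b) (S : Set P.Q) (hS : S.Nonempty)
    (hreach : ∀ q ∈ S, ReachableState P q)
    (hcl : ClosedUnder d (fun x => isXge k a x ∨ isYge k b x) S) :
    2 ^ n ≤ S.ncard := by
  have : Finite P.Q := @Finite.of_fintype _ P.fin
  induction n generalizing a b S with
  | zero => exact hS.ncard_pos
  | succ n ih =>
    set m := max a b with hm
    have ham : a ≤ m := le_max_left a b
    have hbm : b ≤ m := le_max_right a b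
    have hcl₁ : ClosedUnder d (fun x => isXge k (m + 1) x ∨ isYge k b x) S := by
      rintro q hq x (⟨t, rfl, ht⟩ | hx)
      · exact hcl q hq _ (Or.inl ⟨t, rfl, by omega⟩)
      · exact hcl q hq _ (Or.inr hx)
    have hcl₂ : ClosedUnder d (fun x => isXge k a x ∨ isYge k (m + 1) x) S := by
      rintro q hq x (hx | ⟨t, rfl, ht⟩)
      · exact hcl q hq _ (Or.inl hx)
      · exact hcl q hq _ (Or.inr ⟨t, rfl, by omega⟩)
    obtain ⟨R₁, hR₁S, hR₁, hc₁, hl₁⟩ := hcl₁.exists_loops hS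
    obtain ⟨R₂, hR₂S, hR₂, hc₂, hl₂⟩ := hcl₂.exists_loops hS
    have b₁ := ih (m + 1) b (by omega) (by omega) hb R₁ hR₁ (fun q hq => hreach q (hR₁S hq)) hc₁
    have b₂ := ih a (m + 1) (by omega) ha (by omega) R₂ hR₂ (fun q hq => hreach q (hR₂S hq)) hc₂
    have hdisj : Disjoint R₁ R₂ := by
      rw [Set.disjoint_left]
      intro q hq₁ hq₂
      have hr := hreach q (hR₁S hq₁)
      obtain ⟨u, hu, hul⟩ := hl₁ q hq₁
      obtain ⟨v, hv, hvl⟩ := hl₂ q hq₂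
      have hune : u ≠ [] :=
        List.ne_nil_of_mem ((hu (Sum.inl (Fin.last k))).2 (Or.inl ⟨_, rfl, by simp; omega⟩))
      have hvne : v ≠ [] :=
        List.ne_nil_of_mem ((hv (Sum.inr (Fin.last k))).2 (Or.inr ⟨_, rfl, by simp; omega⟩))
      have e₁ := h.evenMin_loop_iff hlang hr u hul hune (m + 1) b hu
        (by omega) (by omega) hb (by omega)
      have e₂ := h.evenMin_loop_iff hlang hr v hvl hvne a (m + 1) hv
        ha (by omega) (by omega) (by omega)
      rw [max_eq_left (by omega)] at e₁
      rw [max_eq_right (by omega)] at e₂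
      have huv : ∀ x, x ∈ u ++ v ↔ isXge k a x ∨ isYge k b x := by
        intro x
        rw [List.mem_append, hu, hv]
        constructor
        · rintro ((⟨t, rfl, ht⟩ | hx) | (hx | ⟨t, rfl, ht⟩))
          · exact Or.inl ⟨t, rfl, by omega⟩
          · exact Or.inr hx
          · exact Or.inl hx
          · exact Or.inr ⟨t, rfl, by omega⟩
        · rintro (hx | hx)
          · exact Or.inr (Or.inl hx)
          · exact Or.inl (Or.inr hx)
      have e := h.evenMin_loop_iff hlang hr (u ++ v) (by simp [hul, hvl]) (by simp [hune]) a b huv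
        ha (by omega) hb (by omega)
      rw [trace_append, hul, List.map_append] at e
      have hmap : ∀ l : List (Sig1 k), l ≠ [] → (trace d q l).map col ≠ [] := by
        intro l hl
        rw [Ne, ← List.length_eq_zero_iff, List.length_map, trace_length]
        simpa using hl
      have e' := evenMin_append (hmap u hune) (hmap v hvne) _ e₁ e₂
      have hodd := e'.symm.trans e
      rw [← hm, Nat.odd_add_one] at hodd
      exact not_iff_self hodd
    calc 2 ^ (n + 1) = 2 ^ n + 2 ^ n := by ring
      _ ≤ R₁.ncard + R₂.ncard := add_le_add b₁ b₂
      _ = (R₁ ∪ R₂).ncard := (Set.ncard_union_eq hdisj).symm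
      _ ≤ S.ncard := Set.ncard_le_ncard (Set.union_subset hR₁S hR₂S)

theorem scc_size_lower_bound (k : ℕ) (P : Automaton (Sig1 k))
    (hdpw : IsDPW P) (hlang : Lang P = ChainLang k (Mlang k))
    (S : Set P.Q) (T : Set (P.Q × Sig1 k × P.Q × ℕ))
    (hscc : IsSCC P S T) (hreach : ∀ q ∈ S, ReachableState P q)
    (i j : ℕ) (hi1 : 1 ≤ i) (hik : i ≤ k) (hj1 : 1 ≤ j) (hjk : j ≤ k)
    (hclosed : RunStaysWithin P S T {c | isXge k i c ∨ isYge k j c}) :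
    2 ^ (k - max i j) ≤ S.ncard := by
  obtain ⟨d, col, h⟩ := hdpw.2.exists_describes
  have hcl : ClosedUnder d (fun x => isXge k i x ∨ isYge k j x) S := by
    intro q hq x hx
    exact (hclosed (fun _ => x) (fun _ => hx) (runFrom d q fun _ => x)
      (fun n => col (runFrom d q (fun _ => x) n, x)) hq
      (fun n => (h _ _ _ _).2 ⟨rfl, rfl⟩) 1).1
  refine le_trans (Nat.pow_le_pow_right two_pos (Nat.le_succ _))
    (h.two_pow_le_ncard hlang (k - max i j + 1) i j ?_ hi1 hj1 S hscc.1 hreach hcl)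
  have := max_le hik hjk
  omega
end

section
/- For every k ∈ ℕ: (i) there exists a deterministic parity automaton with exactly 2^k states recognizing L^k, and every deterministic parity automaton recognizing L^k has at least 2^k states; the same holds for \hat{L}^k; and (ii) there exists a deterministic parity automaton recognizing L^k ∩ \hat{L}^k with at most 2^{4k²}·k^{2k} states. -/
open Classical

open Filter

/-! ## Dominating colors -/

theorem accColorSeq_iff_even {ρ : ℕ → ℕ} {c : ℕ} (h₁ : ∃ᶠ n in atTop, ρ n ≤ c)
    (h₂ : ∀ᶠ n in atTop, c ≤ ρ n) : AccColorSeq ρ ↔ Even c := by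
  have hc : c ∈ InfOcc ρ := fun N => by
    obtain ⟨n, hn, h⟩ := frequently_atTop.1 (h₁.and_eventually h₂) N
    exact ⟨n, hn, le_antisymm h.1 h.2⟩
  have hmin : ∀ c' ∈ InfOcc ρ, c ≤ c' := fun c' hc' => by
    obtain ⟨N, hN⟩ := eventually_atTop.1 h₂
    obtain ⟨n, hn, rfl⟩ := hc' N
    exact hN n hn
  constructor
  · rintro ⟨d, hd, he, hd'⟩
    rwa [le_antisymm (hmin d hd) (hd' c hc)]
  · exact fun he => ⟨c, hc, he, hmin⟩

theorem exists_dominating_color {ρ : ℕ → ℕ} {k : ℕ} (hρ : ∀ n, ρ n ≤ k) :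
    ∃ c ≤ k, (∃ᶠ n in atTop, ρ n ≤ c) ∧ ∀ᶠ n in atTop, c ≤ ρ n := by
  refine ⟨Nat.findGreatest (fun c => ∀ᶠ n in atTop, c ≤ ρ n) k, Nat.findGreatest_le k, ?_, ?_⟩
  · intro h
    have h' : ∀ᶠ n in atTop, Nat.findGreatest (fun c => ∀ᶠ n in atTop, c ≤ ρ n) k + 1 ≤ ρ n :=
      h.mono fun n hn => by simpa using hn
    obtain ⟨n, hn⟩ := h'.exists
    exact Nat.findGreatest_is_greatest (Nat.lt_succ_self _) (hn.trans (hρ n)) h'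
  · exact Nat.findGreatest_spec (P := fun c => ∀ᶠ n in atTop, c ≤ ρ n) (Nat.zero_le k)
      (Eventually.of_forall fun n => Nat.zero_le _)

theorem accColorSeq_shift {ρ ρ' : ℕ → ℕ} {m : ℕ} (h : ∀ n, m ≤ n → ρ n = ρ' n) :
    AccColorSeq ρ ↔ AccColorSeq ρ' := by
  have hI : InfOcc ρ = InfOcc ρ' := by
    ext c
    constructor <;> intro hc N <;> obtain ⟨n, hn, hnc⟩ := hc (max m N) <;>
      have := h n (le_of_max_le_left hn)
    · exact ⟨n, le_of_max_le_right hn, this ▸ hnc⟩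
    · exact ⟨n, le_of_max_le_right hn, this.trans hnc⟩
  simp only [AccColorSeq, hI]

theorem mem_chainLang_iff {α : Type} {k : ℕ} (hk : 1 ≤ k) {C : ℕ → Set (Word α)} {w : Word α}
    {ρ : ℕ → ℕ} (hρ : ∀ n, ρ n ≤ k)
    (hC : ∀ i, 1 ≤ i → i ≤ k → (w ∈ C i ↔ ∀ᶠ n in atTop, i ≤ ρ n)) :
    w ∈ ChainLang k C ↔ AccColorSeq ρ := by
  obtain ⟨c, hck, h₁, h₂⟩ := exists_dominating_color hρ
  have hC' : ∀ i, 1 ≤ i → i ≤ k → (w ∈ C i ↔ i ≤ c) := fun i hi hik => by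
    rw [hC i hi hik]
    constructor
    · intro h
      obtain ⟨n, hn⟩ := (h₁.and_eventually h).exists
      omega
    · exact fun h => h₂.mono fun n hn => h.trans hn
  rw [accColorSeq_iff_even h₁ h₂]
  simp only [ChainLang, Set.mem_ofPred_eq]
  rw [hC' 1 le_rfl hk]
  constructor
  · rintro (h | ⟨i, hi, hik, hw, he, hj⟩)
    · simp [show c = 0 by omega]
    · rw [hC' i hi hik] at hw
      rcases hw.eq_or_lt with rfl | hlt
      · exact he
      · exact absurd ((hC' c (by omega) hck).2 le_rfl) (hj c hlt hck)
  · intro he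
    by_cases hc : 1 ≤ c
    · refine Or.inr ⟨c, hc, hck, (hC' c hc hck).2 le_rfl, he, fun j hj hjk => ?_⟩
      rw [hC' j (by omega) hjk]
      omega
    · exact Or.inl hc

/-! ## Deterministic automata given by step functions -/

def detRun {Q α : Type} (nx : Q → α → Q) (q : Q) (w : Word α) : ℕ → Q
  | 0 => q
  | n + 1 => nx (detRun nx q w n) (w n)

def Automaton.ofStep {α : Type} (Q : Type) [Fintype Q] (q : Q) (nx : Q → α → Q)
    (col : Q → α → ℕ) : Automaton α where
  Q := Q
  fin := inferInstance
  init := q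
  trans p x p' c := p' = nx p x ∧ c = col p x

/-- The transitions of `A` are given by the functions `nx` (successor) and `col` (color). -/
def Automaton.HasStep {α : Type} (A : Automaton α) (nx : A.Q → α → A.Q)
    (col : A.Q → α → ℕ) : Prop :=
  ∀ q x q' c, A.trans q x q' c ↔ q' = nx q x ∧ c = col q x

theorem Automaton.hasStep_ofStep {α : Type} (Q : Type) [Fintype Q] (q : Q) (nx : Q → α → Q)
    (col : Q → α → ℕ) : (Automaton.ofStep Q q nx col).HasStep nx col :=
  fun _ _ _ _ => Iff.rfl

theorem Automaton.HasStep.isDPW {α : Type} {A : Automaton α} {nx : A.Q → α → A.Q}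
    {col : A.Q → α → ℕ} (h : A.HasStep nx col) : IsDPW A := by
  refine ⟨⟨fun q x => ⟨nx q x, col q x, (h _ _ _ _).2 ⟨rfl, rfl⟩⟩, ?_⟩, fun q x => ?_⟩
  · intro q x q₁ c₁ q₂ c₂ h₁ h₂
    rw [((h _ _ _ _).1 h₁).2, ((h _ _ _ _).1 h₂).2]
  · refine ⟨(nx q x, col q x), (h _ _ _ _).2 ⟨rfl, rfl⟩, fun p hp => ?_⟩
    exact Prod.ext ((h _ _ _ _).1 hp).1 ((h _ _ _ _).1 hp).2

theorem IsDPW.exists_hasStep {α : Type} {A : Automaton α} (hA : IsDPW A) :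
    ∃ nx col, A.HasStep nx col := by
  choose f hf huniq using hA.2
  refine ⟨fun q x => (f q x).1, fun q x => (f q x).2, fun q x q' c => ⟨fun h => ?_, ?_⟩⟩
  · have := huniq q x (q', c) h
    exact ⟨congrArg Prod.fst this, congrArg Prod.snd this⟩
  · rintro ⟨rfl, rfl⟩
    exact hf q x

theorem Automaton.HasStep.mem_lang {α : Type} {A : Automaton α} {nx : A.Q → α → A.Q}
    {col : A.Q → α → ℕ} (h : A.HasStep nx col) (w : Word α) :
    w ∈ Lang A ↔ AccColorSeq fun n => col (detRun nx A.init w n) (w n) := by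
  constructor
  · rintro ⟨π, ρ, ⟨h0, hs⟩, hacc⟩
    have hπ : ∀ n, π n = detRun nx A.init w n := fun n => by
      induction n with
      | zero => exact h0
      | succ n ih => rw [((h _ _ _ _).1 (hs n)).1, ih, detRun]
    convert hacc using 2 with n
    rw [((h _ _ _ _).1 (hs n)).2, hπ]
  · exact fun hacc => ⟨_, _, ⟨rfl, fun n => (h _ _ _ _).2 ⟨rfl, rfl⟩⟩, hacc⟩

theorem Automaton.HasStep.mem_lang_congr {α : Type} {A : Automaton α} {nx : A.Q → α → A.Q}
    {col : A.Q → α → ℕ} (h : A.HasStep nx col) {w w' : Word α} {m : ℕ}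
    (hw : ∀ n, m ≤ n → w n = w' n) (hq : detRun nx A.init w m = detRun nx A.init w' m) :
    w ∈ Lang A ↔ w' ∈ Lang A := by
  rw [h.mem_lang, h.mem_lang]
  have hrun : ∀ n, m ≤ n → detRun nx A.init w n = detRun nx A.init w' n := fun n hn => by
    induction n, hn using Nat.le_induction with
    | base => exact hq
    | succ n hn ih => rw [detRun, detRun, ih, hw n hn]
  exact accColorSeq_shift fun n hn => by rw [hrun n hn, hw n hn]

theorem detRun_congr {Q α : Type} (nx : Q → α → Q) (q : Q) {w w' : Word α} {m : ℕ}
    (h : ∀ n, n < m → w n = w' n) : detRun nx q w m = detRun nx q w' m := by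
  induction m with
  | zero => rfl
  | succ m ih => rw [detRun, detRun, ih fun n hn => h n (by omega), h m (by omega)]

/-! ## Renaming letters -/

def Automaton.comap {α β : Type} (f : β → α) (A : Automaton α) : Automaton β where
  Q := A.Q
  fin := A.fin
  init := A.init
  trans q x q' c := A.trans q (f x) q' c

theorem Automaton.lang_comap {α β : Type} (f : β → α) (A : Automaton α) :
    Lang (A.comap f) = {w | (fun n => f (w n)) ∈ Lang A} :=
  rfl

theorem IsDPW.comap {α β : Type} (f : β → α) {A : Automaton α} (h : IsDPW A) :
    IsDPW (A.comap f) :=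
  ⟨⟨fun q x => h.1.1 q (f x), fun q x => h.1.2 q (f x)⟩, fun q x => h.2 q (f x)⟩

/-! ## Appearance records -/

/-- The memory of an appearance record: a pair `(y, x)` is recorded if the event `x` happened
since the last occurrence of the event `y`. -/
abbrev AppearanceRecord (E : Type) : Type := Set {p : E × E // p.1 ≠ p.2}

namespace AppearanceRecord

variable {E : Type}

def update (R : AppearanceRecord E) (D : Set E) : AppearanceRecord E :=
  {p | p.1.1 ∉ D ∧ (p ∈ R ∨ p.1.2 ∈ D)}

/-- The events that happened since the last occurrence of `e`, including the current events. -/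
def since (R : AppearanceRecord E) (D : Set E) (e : E) : Set E :=
  D ∪ {x | ∃ h : e ≠ x, ⟨(e, x), h⟩ ∈ R}

noncomputable def setColor (F : Set (Set E)) (S : Set E) : ℕ :=
  2 * (Nat.card E - S.ncard) + if S ∈ F then 0 else 1

noncomputable def color (F : Set (Set E)) (R : AppearanceRecord E) (D : Set E) : ℕ :=
  sInf {c | c = setColor F ∅ ∨ ∃ e ∈ D, c = setColor F (since R D e)}

def record (D : ℕ → Set E) : ℕ → AppearanceRecord E
  | 0 => ∅
  | n + 1 => update (record D n) (D n)

theorem mem_record {D : ℕ → Set E} {n : ℕ} {p : {p : E × E // p.1 ≠ p.2}} :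
    p ∈ record D n ↔ ∃ s < n, p.1.2 ∈ D s ∧ ∀ r, s ≤ r → r < n → p.1.1 ∉ D r := by
  induction n with
  | zero => simp [record]
  | succ n ih =>
    simp only [record, update, Set.mem_ofPred_eq, ih]
    constructor
    · rintro ⟨hn, ⟨s, hs, hx, hy⟩ | hx⟩
      · refine ⟨s, by omega, hx, fun r hr hrn => ?_⟩
        rcases Nat.lt_succ_iff_lt_or_eq.1 hrn with h | rfl
        · exact hy r hr h
        · exact hn
      · refine ⟨n, by omega, hx, fun r hr hrn => ?_⟩
        obtain rfl : r = n := by omega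
        exact hn
    · rintro ⟨s, hs, hx, hy⟩
      refine ⟨hy n (by omega) (by omega), ?_⟩
      rcases Nat.lt_succ_iff_lt_or_eq.1 hs with h | rfl
      · exact Or.inl ⟨s, h, hx, fun r hr hrn => hy r hr (by omega)⟩
      · exact Or.inr hx

theorem setColor_anti [Finite E] (F : Set (Set E)) {S T : Set E} (h : S ⊆ T) :
    setColor F T ≤ setColor F S := by
  rcases h.eq_or_ssubset with rfl | h
  · exact le_rfl
  · have h₁ := Set.ncard_lt_ncard h (Set.toFinite T)
    have h₂ : T.ncard ≤ Nat.card E := Set.ncard_le_card T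
    unfold setColor
    split_ifs <;> omega

theorem even_setColor (F : Set (Set E)) (S : Set E) : Even (setColor F S) ↔ S ∈ F := by
  unfold setColor
  split_ifs with h <;> simp [h, parity_simps]

theorem eventually_le_color [Finite E] (F : Set (Set E)) (D : ℕ → Set E) :
    ∀ᶠ n in atTop, setColor F {e | ∃ᶠ n in atTop, e ∈ D n} ≤ color F (record D n) (D n) := by
  set I := {e | ∃ᶠ n in atTop, e ∈ D n} with hI
  have hD : ∀ᶠ n in atTop, D n ⊆ I := by
    have : ∀ᶠ n in atTop, ∀ e, e ∈ D n → e ∈ I := by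
      refine eventually_all.2 fun e => ?_
      by_cases he : e ∈ I
      · exact Eventually.of_forall fun n _ => he
      · exact (not_frequently.1 he).mono fun n hn h => absurd h hn
    exact this
  obtain ⟨T, hT⟩ := eventually_atTop.1 hD
  have hocc : ∀ᶠ n in atTop, ∀ e, e ∈ I → ∃ r, T ≤ r ∧ r < n ∧ e ∈ D r := by
    refine eventually_all.2 fun e => ?_
    by_cases he : e ∈ I
    · obtain ⟨r, hr, her⟩ := frequently_atTop.1 he T
      exact (eventually_gt_atTop r).mono fun n hn _ => ⟨r, hr, hn, her⟩
    · exact Eventually.of_forall fun n h => absurd h he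
  filter_upwards [hocc, hD] with n hn hDn
  refine le_csInf ⟨_, Or.inl rfl⟩ ?_
  rintro c (rfl | ⟨e, he, rfl⟩)
  · exact setColor_anti F (Set.empty_subset _)
  · refine setColor_anti F (Set.union_subset hDn ?_)
    rintro x ⟨hne, hx⟩
    obtain ⟨s, hs, hxs, hes⟩ := mem_record.1 hx
    obtain ⟨r, hr, hrn, her⟩ := hn e (hDn he)
    refine hT s ?_ hxs
    by_contra hlt
    exact hes r (by omega) hrn her

theorem frequently_color_le [Finite E] (F : Set (Set E)) (D : ℕ → Set E) :
    ∃ᶠ n in atTop, color F (record D n) (D n) ≤ setColor F {e | ∃ᶠ n in atTop, e ∈ D n} := by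
  set I := {e | ∃ᶠ n in atTop, e ∈ D n} with hI
  refine frequently_atTop.2 fun N => ?_
  rcases I.eq_empty_or_nonempty with hemp | ⟨e₀, he₀⟩
  · exact ⟨N, le_rfl, Nat.sInf_le (Or.inl (by rw [hemp]))⟩
  have hex : ∃ n, ∀ e, e ∈ I → ∃ r, N ≤ r ∧ r ≤ n ∧ e ∈ D r := by
    have : ∀ᶠ n in atTop, ∀ e, e ∈ I → ∃ r, N ≤ r ∧ r ≤ n ∧ e ∈ D r := by
      refine eventually_all.2 fun e => ?_
      by_cases he : e ∈ I
      · obtain ⟨r, hr, her⟩ := frequently_atTop.1 he N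
        exact (eventually_ge_atTop r).mono fun n hn _ => ⟨r, hr, hn, her⟩
      · exact Eventually.of_forall fun n h => absurd h he
    exact this.exists
  obtain ⟨r₀, hr₀, hr₀', -⟩ := Nat.find_spec hex e₀ he₀
  obtain ⟨e, heI, he⟩ : ∃ e ∈ I, ∀ r, N ≤ r → r < Nat.find hex → e ∉ D r := by
    by_contra! h
    have hlt : Nat.find hex ≠ 0 := fun h0 => by
      obtain ⟨r, -, hr, -⟩ := h e₀ he₀
      omega
    refine Nat.find_min hex (Nat.sub_one_lt hlt) fun e he => ?_
    obtain ⟨r, hr, hr', her⟩ := h e he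
    exact ⟨r, hr, by omega, her⟩
  have heD : e ∈ D (Nat.find hex) := by
    obtain ⟨r, hr, hr', her⟩ := Nat.find_spec hex e heI
    rcases hr'.eq_or_lt with h | h
    · rwa [← h]
    · exact absurd her (he r hr h)
  refine ⟨Nat.find hex, hr₀.trans hr₀', (Nat.sInf_le (Or.inr ⟨e, heD, rfl⟩)).trans
    (setColor_anti F fun x hx => ?_)⟩
  obtain ⟨s, hs, hs', hxs⟩ := Nat.find_spec hex x hx
  rcases hs'.eq_or_lt with h | h
  · exact Or.inl (h ▸ hxs)
  · refine Or.inr ⟨fun hex' => he s hs h (hex' ▸ hxs), mem_record.2 ⟨s, h, hxs, ?_⟩⟩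
    exact fun r hr hrn => he r (hs.trans hr) hrn

theorem accColorSeq_color [Finite E] (F : Set (Set E)) (D : ℕ → Set E) :
    AccColorSeq (fun n => color F (record D n) (D n)) ↔ {e | ∃ᶠ n in atTop, e ∈ D n} ∈ F := by
  rw [accColorSeq_iff_even (frequently_color_le F D) (eventually_le_color F D), even_setColor]

theorem card [Fintype E] :
    Nat.card (AppearanceRecord E) = 2 ^ (Fintype.card E * Fintype.card E - Fintype.card E) := by
  have h : (Finset.univ.filter fun p : E × E => p.1 ≠ p.2) = (Finset.univ : Finset E).offDiag := by
    ext p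
    simp
  rw [Nat.card_eq_fintype_card, Fintype.card_set, Fintype.card_subtype, h, Finset.offDiag_card,
    Finset.card_univ]

end AppearanceRecord

/-! ## Intersection of deterministic parity automata -/

/-- The sets of pairs (component, color below `k`) for which, in both components, the least color
of the component is even, where color `k` counts as present. -/
def evenMinima (k : ℕ) : Set (Set (Bool × Fin k)) :=
  {S | ∀ b, ∃ c ≤ k, Even c ∧ (∀ h : c < k, (b, ⟨c, h⟩) ∈ S) ∧ ∀ i : Fin k, i.val < c → (b, i) ∉ S}

theorem mem_evenMinima {k : ℕ} {ρ : Bool → ℕ → ℕ} (hρ : ∀ b n, ρ b n ≤ k) :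
    {e : Bool × Fin k | ∃ᶠ n in atTop, ρ e.1 n = e.2.val} ∈ evenMinima k ↔
      ∀ b, AccColorSeq (ρ b) := by
  refine forall_congr' fun b => ?_
  constructor
  · rintro ⟨c, hck, he, hc, hi⟩
    have hge : ∀ᶠ n in atTop, c ≤ ρ b n := by
      have : ∀ᶠ n in atTop, ∀ i : Fin k, i.val < c → ρ b n ≠ i.val :=
        eventually_all.2 fun i => by
          by_cases h : i.val < c
          · exact (not_frequently.1 (hi i h)).mono fun n hn _ => hn
          · exact Eventually.of_forall fun n h' => absurd h' h
      filter_upwards [this] with n hn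
      by_contra! hlt
      exact hn ⟨ρ b n, by omega⟩ hlt rfl
    refine (accColorSeq_iff_even ?_ hge).2 he
    by_cases h : c < k
    · exact (hc h).mono fun n hn => le_of_eq hn
    · exact Frequently.of_forall fun n => (hρ b n).trans (by omega)
  · rintro ⟨c, hc, he, hmin⟩
    obtain ⟨n, -, hn⟩ := hc 0
    refine ⟨c, hn ▸ hρ b n, he, fun h => frequently_atTop.2 hc, fun i hi h => ?_⟩
    exact absurd (hmin i.val (frequently_atTop.1 h)) (by omega)

theorem exists_dpw_inter {α : Type} {k : ℕ} {A B : Automaton α} (hA : IsDPW A) (hB : IsDPW B)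
    (hAk : ∀ q x q' c, A.trans q x q' c → c ≤ k) (hBk : ∀ q x q' c, B.trans q x q' c → c ≤ k) :
    ∃ P : Automaton α, IsDPW P ∧ Lang P = Lang A ∩ Lang B ∧
      P.size = A.size * B.size * 2 ^ (2 * k * (2 * k) - 2 * k) := by
  obtain ⟨nA, cA, hA⟩ := hA.exists_hasStep
  obtain ⟨nB, cB, hB⟩ := hB.exists_hasStep
  let _ := A.fin
  let _ := B.fin
  let cols (a : A.Q) (b : B.Q) (x : α) (i : Bool) : ℕ := bif i then cA a x else cB b x
  let ev (a : A.Q) (b : B.Q) (x : α) : Set (Bool × Fin k) := {e | cols a b x e.1 = e.2.val}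
  let Q := A.Q × B.Q × AppearanceRecord (Bool × Fin k)
  let nx (q : Q) (x : α) : Q :=
    (nA q.1 x, nB q.2.1 x, AppearanceRecord.update q.2.2 (ev q.1 q.2.1 x))
  let col (q : Q) (x : α) : ℕ :=
    AppearanceRecord.color (evenMinima k) q.2.2 (ev q.1 q.2.1 x)
  have hP := Automaton.hasStep_ofStep Q (A.init, B.init, ∅) nx col
  refine ⟨_, hP.isDPW, ?_, ?_⟩
  · ext w
    rw [Set.mem_inter_iff, hP.mem_lang, hA.mem_lang, hB.mem_lang]
    let D (n : ℕ) : Set (Bool × Fin k) :=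
      ev (detRun nA A.init w n) (detRun nB B.init w n) (w n)
    have hrun : ∀ n, detRun nx (A.init, B.init, ∅) w n =
        (detRun nA A.init w n, detRun nB B.init w n, AppearanceRecord.record D n) := fun n => by
      induction n with
      | zero => rfl
      | succ n ih => rw [detRun, ih]; rfl
    have hcol : ∀ n, col (detRun nx (A.init, B.init, ∅) w n) (w n) =
        AppearanceRecord.color (evenMinima k) (AppearanceRecord.record D n) (D n) := fun n => by
      rw [hrun]
    have hk : ∀ b n, cols (detRun nA A.init w n) (detRun nB B.init w n) (w n) b ≤ k := by
      rintro (_ | _) n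
      · exact hBk _ _ _ _ ((hB _ _ _ _).2 ⟨rfl, rfl⟩)
      · exact hAk _ _ _ _ ((hA _ _ _ _).2 ⟨rfl, rfl⟩)
    change AccColorSeq (fun n => col (detRun nx (A.init, B.init, ∅) w n) (w n)) ↔ _
    rw [funext hcol, AppearanceRecord.accColorSeq_color]
    refine (mem_evenMinima (ρ := fun b n =>
      cols (detRun nA A.init w n) (detRun nB B.init w n) (w n) b) hk).trans ?_
    rw [Bool.forall_bool, and_comm]
    rfl
  · change Fintype.card Q = _
    rw [Fintype.card_prod, Fintype.card_prod, ← Nat.card_eq_fintype_card (α := AppearanceRecord _),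
      AppearanceRecord.card, Fintype.card_prod, Fintype.card_bool, Fintype.card_fin]
    exact (mul_assoc _ _ _).symm

/-! ## The parity automaton for `L^k` -/

/-- The state `p` records for each `i` whether the number of letters `X_i` seen so far is even. -/
def countStep (k : ℕ) (p : Fin k → Bool) : Sig2 k → Fin k → Bool
  | Sum.inl m => Function.update p m (!p m)
  | _ => p

/-- The letter `x` is admissible for the `i`-th language of the chain under the parities `p`. -/
def Admissible (k : ℕ) (p : Fin k → Bool) (x : Sig2 k) (i : ℕ) : Prop :=
  isaLe2 k (4 * k - 2 * i) x ∨
    (isaLe2 k (4 * k - 2 * i + 1) x ∧ ∃ j : Fin k, j.val + 1 = i ∧ p j = true)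

noncomputable def levelColor (k : ℕ) (p : Fin k → Bool) (x : Sig2 k) : ℕ :=
  Nat.findGreatest (Admissible k p x) k

theorem isaLe2.mono {k i j : ℕ} (h : i ≤ j) {x : Sig2 k} (hx : isaLe2 k i x) : isaLe2 k j x := by
  obtain ⟨m, rfl, hm⟩ := hx
  exact ⟨m, rfl, hm.trans h⟩

theorem Admissible.isaLe2 {k i : ℕ} {p : Fin k → Bool} {x : Sig2 k} (h : Admissible k p x i) :
    isaLe2 k (4 * k - 2 * i + 1) x :=
  h.elim (fun h => h.mono (Nat.le_succ _)) And.left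

theorem Admissible.anti {k i j : ℕ} {p : Fin k → Bool} {x : Sig2 k} (hij : i ≤ j) (hj : j ≤ k)
    (h : Admissible k p x j) : Admissible k p x i := by
  rcases hij.eq_or_lt with rfl | hlt
  · exact h
  · exact Or.inl (h.isaLe2.mono (by omega))

theorem le_levelColor_iff {k i : ℕ} {p : Fin k → Bool} {x : Sig2 k} (hi : 1 ≤ i) (hik : i ≤ k) :
    i ≤ levelColor k p x ↔ Admissible k p x i := by
  refine ⟨fun h => ?_, Nat.le_findGreatest hik⟩
  exact (Nat.findGreatest_of_ne_zero (m := levelColor k p x) rfl (by omega)).anti h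
    (Nat.findGreatest_le k)

theorem isX2_succ_iff {k : ℕ} {j : Fin k} {x : Sig2 k} :
    isX2 k (j.val + 1) x ↔ x = Sum.inl j := by
  constructor
  · rintro ⟨m, rfl, hm⟩
    rw [Fin.ext (Nat.succ_injective hm)]
  · exact fun h => ⟨j, h, rfl⟩

theorem isaLe2.not_isX2 {k i j : ℕ} {x : Sig2 k} (h : isaLe2 k i x) : ¬ isX2 k j x := by
  obtain ⟨m, rfl, -⟩ := h
  rintro ⟨m', h, -⟩
  cases h

theorem detRun_countStep {k : ℕ} (w : Word (Sig2 k)) (j : Fin k) (n : ℕ) :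
    detRun (countStep k) (fun _ => true) w n j = true ↔
      Even ((Finset.range n).filter fun m => isX2 k (j.val + 1) (w m)).card := by
  induction n with
  | zero => simp [detRun]
  | succ n ih =>
    rw [detRun, Finset.range_add_one, Finset.filter_insert]
    by_cases h : w n = Sum.inl j
    · rw [if_pos (isX2_succ_iff.2 h), Finset.card_insert_of_notMem (by simp), Nat.even_add_one,
        ← ih, h]
      simp [countStep]
    · rw [if_neg (mt isX2_succ_iff.1 h), ← ih]
      rcases hw : w n with m | x
      · have : j ≠ m := fun hm => h (hm ▸ hw)
        simp [countStep, Function.update_of_ne this]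
      · rfl

theorem ncard_eq_card_filter_range {P : ℕ → Prop} {N n : ℕ} (hN : ∀ m, N ≤ m → ¬ P m)
    (hn : N ≤ n) : {m | P m}.Finite ∧ {m | P m}.ncard = ((Finset.range n).filter P).card := by
  have h : {m | P m} = ((Finset.range n).filter P : Finset ℕ) := by
    ext m
    simp only [Finset.coe_filter, Finset.mem_range, Set.mem_ofPred_eq]
    refine ⟨fun hm => ⟨?_, hm⟩, And.right⟩
    by_contra! hle
    exact hN m (hn.trans hle) hm
  rw [h]
  exact ⟨Finset.finite_toSet _, Set.ncard_coe_finset _⟩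

theorem mem_LL_iff {k i : ℕ} (hi : 1 ≤ i) (hik : i ≤ k) (w : Word (Sig2 k)) :
    w ∈ LL k i ↔
      ∀ᶠ n in atTop, i ≤ levelColor k (detRun (countStep k) (fun _ => true) w n) (w n) := by
  obtain ⟨j, rfl⟩ : ∃ j : Fin k, j.val + 1 = i := ⟨⟨i - 1, by omega⟩, by simp; omega⟩
  simp only [le_levelColor_iff hi hik]
  constructor
  · rintro (⟨N, hN⟩ | ⟨hfin, heven, N, hN⟩)
    · exact eventually_atTop.2 ⟨N, fun n hn => Or.inl (hN n hn)⟩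
    · refine eventually_atTop.2 ⟨N, fun n hn => Or.inr ⟨hN n hn, j, rfl, ?_⟩⟩
      rw [detRun_countStep, ← (ncard_eq_card_filter_range (fun m hm => (hN m hm).not_isX2) hn).2]
      exact heven
  · intro h
    obtain ⟨N, hN⟩ := eventually_atTop.1 h
    have hX : ∀ m, N ≤ m → ¬ isX2 k (j.val + 1) (w m) := fun m hm => (hN m hm).isaLe2.not_isX2
    by_cases heven : Even {m | isX2 k (j.val + 1) (w m)}.ncard
    · exact Or.inr ⟨(ncard_eq_card_filter_range hX le_rfl).1, heven, N, fun n hn =>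
        (hN n hn).isaLe2⟩
    · refine Or.inl ⟨N, fun n hn => (hN n hn).resolve_right ?_⟩
      rintro ⟨-, j', hj', hp⟩
      obtain rfl : j' = j := Fin.ext (by omega)
      rw [detRun_countStep, ← (ncard_eq_card_filter_range hX hn).2] at hp
      exact heven hp

theorem exists_dpw_Lbig {k : ℕ} (hk : 1 ≤ k) :
    ∃ P : Automaton (Sig2 k), IsDPW P ∧ Lang P = Lbig k ∧ P.size = 2 ^ k ∧
      ∀ q x q' c, P.trans q x q' c → c ≤ k := by
  have hP := Automaton.hasStep_ofStep (Fin k → Bool) (fun _ => true) (countStep k) (levelColor k)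
  refine ⟨_, hP.isDPW, ?_, ?_, ?_⟩
  · ext w
    rw [hP.mem_lang]
    exact (mem_chainLang_iff hk (fun n => Nat.findGreatest_le k)
      fun i hi hik => mem_LL_iff hi hik w).symm
  · change Fintype.card (Fin k → Bool) = _
    simp
  · rintro q x q' c ⟨-, rfl⟩
    exact Nat.findGreatest_le k

/-! ## The lower bound for `L^k` -/

/-- The word whose first `k` letters contain `X_{j+1}` exactly for the `j` with `S j = true`,
and that continues with `a_{4k−2i−1}` forever. -/
def probeWord {k : ℕ} (S : Fin k → Bool) (i : Fin k) : Word (Sig2 k) := fun n =>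
  if h : n < k then
    if S ⟨n, h⟩ then Sum.inl ⟨n, h⟩ else Sum.inr (Sum.inr ⟨0, by omega⟩)
  else Sum.inr (Sum.inr ⟨4 * k - 2 * (i.val + 1) + 1, by omega⟩)

theorem eventually_isaLe2_probeWord {k : ℕ} (S : Fin k → Bool) (i : Fin k) (j : ℕ) :
    (∃ N, ∀ n, N ≤ n → isaLe2 k j (probeWord S i n)) ↔ 4 * k - 2 * (i.val + 1) + 1 ≤ j := by
  constructor
  · rintro ⟨N, hN⟩
    obtain ⟨m, hm, hmj⟩ := hN (max N k) (le_max_left _ _)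
    rw [probeWord, dif_neg (by simp)] at hm
    obtain rfl := Sum.inr_injective (Sum.inr_injective hm)
    exact hmj
  · refine fun h => ⟨k, fun n hn => ⟨⟨4 * k - 2 * (i.val + 1) + 1, by omega⟩, ?_,
      h⟩⟩
    rw [probeWord, dif_neg (by omega)]

theorem isX2_probeWord {k : ℕ} (S : Fin k → Bool) (i j : Fin k) (n : ℕ) :
    isX2 k (j.val + 1) (probeWord S i n) ↔ n = j.val ∧ S j = true := by
  rw [isX2_succ_iff, probeWord]
  split_ifs with h hS
  · constructor
    · intro h'
      obtain rfl := Sum.inl_injective h'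
      exact ⟨rfl, hS⟩
    · rintro ⟨rfl, -⟩
      rfl
  · simp only [false_iff]
    rintro ⟨rfl, h'⟩
    exact hS h'
  · simp only [false_iff]
    rintro ⟨rfl, -⟩
    exact h j.isLt

theorem probeWord_mem_Lbig {k : ℕ} (S : Fin k → Bool) (i : Fin k) :
    probeWord S i ∈ Lbig k ↔ Even (if S i then i.val else i.val + 1) := by
  have hi := i.isLt
  have hle : (if S i then i.val else i.val + 1) ≤ k := by split_ifs <;> omega
  have hconst := accColorSeq_iff_even (ρ := fun _ => if S i then i.val else i.val + 1)
    (Frequently.of_forall fun _ => le_rfl) (Eventually.of_forall fun _ => le_rfl)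
  rw [← hconst]
  refine mem_chainLang_iff (by omega) (fun _ => hle) fun i' hi' hik => ?_
  rw [eventually_const]
  simp only [LL, Set.mem_ofPred_eq, eventually_isaLe2_probeWord]
  rcases lt_trichotomy i' (i.val + 1) with h | rfl | h
  · exact iff_of_true (Or.inl (by omega)) (by split_ifs <;> omega)
  · simp only [isX2_probeWord]
    by_cases hS : S i = true
    · simp [hS]
    · simp [hS]
  · refine iff_of_false ?_ (by split_ifs <;> omega)
    rintro (h' | ⟨-, -, h'⟩) <;> omega

theorem two_pow_le_size_of_lang_eq_Lbig {k : ℕ} {P : Automaton (Sig2 k)} (hP : IsDPW P)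
    (hL : Lang P = Lbig k) : 2 ^ k ≤ P.size := by
  obtain ⟨nx, col, h⟩ := hP.exists_hasStep
  let _ := P.fin
  rcases Nat.eq_zero_or_pos k with rfl | hk
  · exact Fintype.card_pos_iff.2 ⟨P.init⟩
  have hpre : ∀ (S : Fin k → Bool) (i j : Fin k),
      detRun nx P.init (probeWord S i) k = detRun nx P.init (probeWord S j) k := fun S i j =>
    detRun_congr nx P.init fun n hn => by rw [probeWord, probeWord, dif_pos hn, dif_pos hn]
  have hinj : Function.Injective fun S : Fin k → Bool =>
      detRun nx P.init (probeWord S ⟨0, hk⟩) k := by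
    intro S S' hSS'
    by_contra hne
    obtain ⟨i, hi⟩ := Function.ne_iff.1 hne
    have hmem : probeWord S i ∈ Lang P ↔ probeWord S' i ∈ Lang P := by
      refine h.mem_lang_congr (m := k) (fun n hn => ?_) ?_
      · rw [probeWord, probeWord, dif_neg (by omega), dif_neg (by omega)]
      · rw [hpre S i ⟨0, hk⟩, hpre S' i ⟨0, hk⟩]
        exact hSS'
    rw [hL, probeWord_mem_Lbig, probeWord_mem_Lbig] at hmem
    cases hS : S i <;> cases hS' : S' i <;> simp_all [Nat.even_add_one, -Nat.not_even_iff_odd]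
  calc 2 ^ k = Fintype.card (Fin k → Bool) := by simp
    _ ≤ P.size := Fintype.card_le_of_injective _ hinj

/-! ## The mirrored chain -/

/-- The involution that exchanges `X_i` with `Y_i` and `a_m` with `a_{4k−1−m}`. -/
def mirror (k : ℕ) : Sig2 k → Sig2 k
  | Sum.inl m => Sum.inr (Sum.inl m)
  | Sum.inr (Sum.inl m) => Sum.inl m
  | Sum.inr (Sum.inr m) => Sum.inr (Sum.inr m.rev)

theorem mirror_mirror {k : ℕ} (x : Sig2 k) : mirror k (mirror k x) = x := by
  rcases x with m | m | m <;> simp [mirror]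

theorem isY2_iff_mirror {k j : ℕ} (x : Sig2 k) : isY2 k j x ↔ isX2 k j (mirror k x) := by
  rcases x with m | m | m <;> simp [isY2, isX2, mirror]

theorem isaGe2_iff_mirror {k i j : ℕ} (h : i + j + 1 = 4 * k) (x : Sig2 k) :
    isaGe2 k i x ↔ isaLe2 k j (mirror k x) := by
  rcases x with m | m | m
  · simp [isaGe2, isaLe2, mirror]
  · simp [isaGe2, isaLe2, mirror]
  · have := m.isLt
    simp only [isaGe2, isaLe2, mirror, Sum.inr.injEq, exists_eq_left', Fin.val_rev]
    omega

theorem mem_LLhat_iff {k j : ℕ} (hj : 1 ≤ j) (hjk : j ≤ k) (w : Word (Sig2 k)) :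
    w ∈ LLhat k j ↔ (fun n => mirror k (w n)) ∈ LL k j := by
  simp only [LLhat, LL, Set.mem_ofPred_eq, isY2_iff_mirror,
    isaGe2_iff_mirror (show 2 * j - 1 + (4 * k - 2 * j) + 1 = 4 * k by omega),
    isaGe2_iff_mirror (show 2 * j - 2 + (4 * k - 2 * j + 1) + 1 = 4 * k by omega)]

theorem mem_chainLang_congr {α β : Type} {k : ℕ} (hk : 1 ≤ k) {C : ℕ → Set (Word α)}
    {C' : ℕ → Set (Word β)} {w : Word α} {w' : Word β}
    (h : ∀ i, 1 ≤ i → i ≤ k → (w ∈ C i ↔ w' ∈ C' i)) :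
    w ∈ ChainLang k C ↔ w' ∈ ChainLang k C' := by
  simp only [ChainLang, Set.mem_ofPred_eq, h 1 le_rfl hk]
  refine or_congr_right (exists_congr fun i => and_congr_right fun hi => and_congr_right
    fun hik => and_congr (h i hi hik) (and_congr_right fun _ => forall_congr' fun j =>
      forall_congr' fun hj => forall_congr' fun hjk => not_congr (h j (by omega) hjk)))

theorem Lbighat_eq {k : ℕ} (hk : 1 ≤ k) :
    Lbighat k = {w | (fun n => mirror k (w n)) ∈ Lbig k} :=
  Set.ext fun w => mem_chainLang_congr hk fun _ hi hik => mem_LLhat_iff hi hik w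

theorem Lbig_eq {k : ℕ} (hk : 1 ≤ k) :
    Lbig k = {w | (fun n => mirror k (w n)) ∈ Lbighat k} := by
  rw [Lbighat_eq hk]
  simp only [Set.mem_ofPred_eq, mirror_mirror]
  rfl

theorem parity_sizes (k : ℕ) :
    -- (i) minimal DPW sizes for L^k and for \hat L^k are exactly 2^k
    (∃ P : Automaton (Sig2 k), IsDPW P ∧ Lang P = Lbig k ∧ P.size = 2 ^ k) ∧
    (∀ P : Automaton (Sig2 k), IsDPW P → Lang P = Lbig k → 2 ^ k ≤ P.size) ∧
    (∃ P : Automaton (Sig2 k), IsDPW P ∧ Lang P = Lbighat k ∧ P.size = 2 ^ k) ∧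
    (∀ P : Automaton (Sig2 k), IsDPW P → Lang P = Lbighat k → 2 ^ k ≤ P.size) ∧
    -- (ii) a DPW for the intersection with at most 2^(4k²)·k^(2k) states
    (∃ P : Automaton (Sig2 k), IsDPW P ∧ Lang P = Lbig k ∩ Lbighat k ∧
        P.size ≤ 2 ^ (4 * k ^ 2) * k ^ (2 * k)) := by
  rcases Nat.eq_zero_or_pos k with rfl | hk
  · have hw : IsEmpty (Word (Sig2 0)) := ⟨fun w => by rcases w 0 with m | m | m <;> exact m.elim0⟩
    have hP := Automaton.hasStep_ofStep Unit () (fun _ (_ : Sig2 0) => ()) fun _ _ => 0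
    have hpos : ∀ P : Automaton (Sig2 0), 2 ^ 0 ≤ P.size := fun P =>
      (@Fintype.card_pos_iff _ P.fin).2 ⟨P.init⟩
    exact ⟨⟨_, hP.isDPW, Subsingleton.elim _ _, rfl⟩, fun P _ _ => hpos P,
      ⟨_, hP.isDPW, Subsingleton.elim _ _, rfl⟩, fun P _ _ => hpos P,
      ⟨_, hP.isDPW, Subsingleton.elim _ _, le_rfl⟩⟩
  obtain ⟨A, hA, hAL, hAs, hAk⟩ := exists_dpw_Lbig hk
  have hB := hA.comap (mirror k)
  have hBL : Lang (A.comap (mirror k)) = Lbighat k := by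
    rw [Automaton.lang_comap, hAL, Lbighat_eq hk]
  have hBs : (A.comap (mirror k)).size = 2 ^ k := hAs
  refine ⟨⟨A, hA, hAL, hAs⟩, fun P hP hL => two_pow_le_size_of_lang_eq_Lbig hP hL,
    ⟨_, hB, hBL, hBs⟩, fun P hP hL => ?_, ?_⟩
  · refine two_pow_le_size_of_lang_eq_Lbig (P := P.comap (mirror k)) (hP.comap _) ?_
    rw [Automaton.lang_comap, hL, Lbig_eq hk]
  · obtain ⟨P, hP, hPL, hPs⟩ := exists_dpw_inter hA hB hAk fun q x => hAk q (mirror k x)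
    refine ⟨P, hP, by rw [hPL, hAL, hBL], ?_⟩
    have hexp : k + k + (2 * k * (2 * k) - 2 * k) = 4 * k ^ 2 := by
      have : 2 * k ≤ 2 * k * (2 * k) := Nat.le_mul_of_pos_right _ (by omega)
      have : 2 * k * (2 * k) = 4 * k ^ 2 := by ring
      omega
    rw [hPs, hAs, hBs, ← pow_add, ← pow_add, hexp]
    exact Nat.le_mul_of_pos_right _ (Nat.pow_pos hk)
end
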